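/- (Equivalence of the graphical and potential-outcomes frameworks.) Fix j ∈ {1,…,n} and ξ ∈ ℝ. Then: (i) for every subset P ⊆ P_{ε_i,x_j} of paths from ε_i to x_j there exists an assignment vector a ∈ {0,ξ}^{η(j)} such that Q_ξ(P) = C_j(a); and (ii) for every assignment vector a ∈ {0,ξ}^{η(j)} there exists a subset P ⊆ P_{ε_i,x_j} such that C_j(a) = Q_ξ(P). -/

import Mathlib

open Matrix Finset

namespace TCA

variable {n m : ℕ}

/-- Weight of the tail of a path after a given previous index:
for `prev` and `[k₁, …, k_t]` this is `B k₁ prev * B k₂ k₁ * ⋯ * B k_t k_{t-1}`. -/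
def tailWeight (B : Matrix (Fin n) (Fin n) ℝ) : Fin n → List (Fin n) → ℝ
  | _, [] => 1
  | prev, k :: rest => B k prev * tailWeight B k rest

/-- Weight of a shock-to-variable path `[k₀, …, k_t]` for shock `i`:
`Ω k₀ i * B k₁ k₀ * ⋯ * B k_t k_{t−1}`. -/
def shockListWeight (B : Matrix (Fin n) (Fin n) ℝ) (Ω : Matrix (Fin n) (Fin m) ℝ)
    (i : Fin m) : List (Fin n) → ℝ
  | [] => 0
  | k :: rest => Ω k i * tailWeight B k rest

/-- Weight of a variable-to-variable path `[k₀, …, k_t]`: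
`B k₁ k₀ * ⋯ * B k_t k_{t−1}` (equal to `1` for a single-element path). -/
def varListWeight (B : Matrix (Fin n) (Fin n) ℝ) : List (Fin n) → ℝ
  | [] => 0
  | k :: rest => tailWeight B k rest

/-- A path from the shock to `x_j`, identified with its (nonempty) set of indices:
a strictly increasing sequence ending at `j` is exactly a finite set containing `j`
with all elements `≤ j`. -/
def PathTo (j : Fin n) (S : Finset (Fin n)) : Prop := j ∈ S ∧ ∀ k ∈ S, k ≤ j

/-- A path from `x_r` to `x_s`, identified with its set of indices: a strictly
increasing sequence starting at `r` and ending at `s`. -/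
def PathBetween (r s : Fin n) (S : Finset (Fin n)) : Prop :=
  r ∈ S ∧ s ∈ S ∧ ∀ k ∈ S, r ≤ k ∧ k ≤ s

instance (j : Fin n) : DecidablePred (PathTo j) := fun _ => by
  unfold PathTo; infer_instance

instance (r s : Fin n) : DecidablePred (PathBetween r s) := fun _ => by
  unfold PathBetween; infer_instance

/-- The set `P_{ε_i, x_j}` of all paths from the shock to `x_j`. -/
def allPathsTo (j : Fin n) : Finset (Finset (Fin n)) :=
  Finset.univ.filter (PathTo j)

/-- The set `P_{x_r, x_s}` of all paths from `x_r` to `x_s`. -/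
def allPathsBetween (r s : Fin n) : Finset (Finset (Fin n)) :=
  Finset.univ.filter (PathBetween r s)

/-- Weight of a shock-to-variable path given as a set of indices (the weight of its
strictly increasing enumeration). -/
def wShock (B : Matrix (Fin n) (Fin n) ℝ) (Ω : Matrix (Fin n) (Fin m) ℝ)
    (i : Fin m) (S : Finset (Fin n)) : ℝ :=
  shockListWeight B Ω i (S.sort (· ≤ ·))

/-- Weight of a variable-to-variable path given as a set of indices. -/
def wVar (B : Matrix (Fin n) (Fin n) ℝ) (S : Finset (Fin n)) : ℝ :=
  varListWeight B (S.sort (· ≤ ·))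

/-- Total path-specific effect `Q_ξ(P) = ξ · Σ_{p ∈ P} weight(p)`. -/
def Q (ξ : ℝ) (w : Finset (Fin n) → ℝ) (P : Finset (Finset (Fin n))) : ℝ :=
  ξ * ∑ p ∈ P, w p


/-- The potential-outcome causal-effect functional `C_j` (0-based index `j`,
so `η(j) = 2^j` and the block of coordinates of the assignment vector tracking
the dependence on variable `k < j` is `[2^k − 1, 2^{k+1} − 1)`):
`C_0 a = Ω_{0,i}·a_0` and
`C_{j+1} a = Σ_{k ≤ j} B_{j+1,k} · C_k (a restricted to block k) + Ω_{j+1,i} · a_last`. -/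
noncomputable def C {n m : ℕ} (B : Matrix (Fin n) (Fin n) ℝ)
    (Ω : Matrix (Fin n) (Fin m) ℝ) (i : Fin m) :
    (j : ℕ) → j < n → (Fin (2 ^ j) → ℝ) → ℝ
  | 0, hj, a => Ω ⟨0, hj⟩ i * a ⟨0, by norm_num⟩
  | j + 1, hj, a =>
      (∑ k : Fin (j + 1),
          B ⟨j + 1, hj⟩ ⟨(k : ℕ), Nat.lt_trans k.isLt hj⟩ *
            C B Ω i (k : ℕ) (Nat.lt_trans k.isLt hj)
              (fun t => a ⟨2 ^ (k : ℕ) - 1 + (t : ℕ), by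
                have ht := t.isLt
                have h1 : 2 ^ ((k : ℕ) + 1) ≤ 2 ^ (j + 1) :=
                  Nat.pow_le_pow_right (by norm_num)
                    (Nat.succ_le_succ (Nat.le_of_lt_succ k.isLt))
                have h2 : 2 ^ ((k : ℕ) + 1) = 2 ^ (k : ℕ) * 2 := pow_succ 2 (k : ℕ)
                omega⟩))
        + Ω ⟨j + 1, hj⟩ i *
            a ⟨2 ^ (j + 1) - 1, by
              have h : 0 < 2 ^ (j + 1) := pow_pos (by norm_num) (j + 1)
              omega⟩
  termination_by j _ _ => j
  decreasing_by exact k.isLt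

lemma tailWeight_append_pair (B : Matrix (Fin n) (Fin n) ℝ) (p k J : Fin n)
    (l : List (Fin n)) :
    tailWeight B p (l ++ [k] ++ [J]) = B J k * tailWeight B p (l ++ [k]) := by
  induction l generalizing p with
  | nil => simp [tailWeight, mul_comm]
  | cons q l ih =>
    simp only [List.cons_append, tailWeight] at ih ⊢
    rw [ih]
    ring

lemma shockListWeight_append_pair (B : Matrix (Fin n) (Fin n) ℝ)
    (Ω : Matrix (Fin n) (Fin m) ℝ) (i : Fin m) (k J : Fin n) (l : List (Fin n)) :
    shockListWeight B Ω i (l ++ [k] ++ [J]) = B J k * shockListWeight B Ω i (l ++ [k]) := by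
  cases l with
  | nil => simp [shockListWeight, tailWeight, mul_comm]
  | cons q l =>
    have h := tailWeight_append_pair B q k J l
    simp only [List.cons_append, shockListWeight] at h ⊢
    rw [h]
    ring

lemma sort_insert_of_forall_lt {J : Fin n} {S : Finset (Fin n)} (h : ∀ k ∈ S, k < J) :
    (insert J S).sort (· ≤ ·) = S.sort (· ≤ ·) ++ [J] := by
  have hJ : J ∉ S := fun hJ => lt_irrefl _ (h J hJ)
  refine List.Perm.eq_of_pairwise' (r := (· ≤ ·)) (Finset.pairwise_sort _ _) ?_ ?_
  · rw [List.pairwise_append]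
    refine ⟨Finset.pairwise_sort _ _, List.pairwise_singleton _ _, ?_⟩
    intro a ha b hb
    rw [List.mem_singleton.1 hb]
    exact (h a ((Finset.mem_sort _).1 ha)).le
  · rw [List.perm_ext_iff_of_nodup (Finset.sort_nodup _ _)]
    · intro a
      simp [or_comm]
    · rw [List.nodup_append]
      refine ⟨Finset.sort_nodup _ _, List.nodup_singleton _, ?_⟩
      rintro a ha b hb rfl
      exact hJ (List.mem_singleton.1 hb ▸ (Finset.mem_sort _).1 ha)

lemma mem_allPathsTo {j : Fin n} {S : Finset (Fin n)} :
    S ∈ allPathsTo j ↔ j ∈ S ∧ ∀ k ∈ S, k ≤ j := by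
  simp [allPathsTo, PathTo]

lemma wShock_singleton (B : Matrix (Fin n) (Fin n) ℝ) (Ω : Matrix (Fin n) (Fin m) ℝ)
    (i : Fin m) (J : Fin n) : wShock B Ω i {J} = Ω J i := by
  simp [wShock, shockListWeight, tailWeight]

lemma wShock_insert (B : Matrix (Fin n) (Fin n) ℝ) (Ω : Matrix (Fin n) (Fin m) ℝ)
    (i : Fin m) {k J : Fin n} (hkJ : k < J) {S : Finset (Fin n)} (hS : S ∈ allPathsTo k) :
    wShock B Ω i (insert J S) = B J k * wShock B Ω i S := by
  obtain ⟨hk, hle⟩ := mem_allPathsTo.1 hS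
  have hsort : S.sort (· ≤ ·) = (S.erase k).sort (· ≤ ·) ++ [k] := by
    conv_lhs => rw [← Finset.insert_erase hk]
    refine sort_insert_of_forall_lt fun x hx => ?_
    exact lt_of_le_of_ne (hle x (Finset.mem_of_mem_erase hx)) (Finset.ne_of_mem_erase hx)
  rw [wShock, wShock, sort_insert_of_forall_lt fun x hx => (hle x hx).trans_lt hkJ, hsort,
    shockListWeight_append_pair]

/-- A path to `J` is either the one-step path `{J}` or a path to some `k < J` extended by `J`. -/
lemma sum_allPathsTo (J : Fin n) (F : Finset (Fin n) → ℝ) :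
    ∑ S ∈ allPathsTo J, F S =
      (∑ k : Fin J, ∑ S ∈ allPathsTo ⟨k, k.isLt.trans J.isLt⟩, F (insert J S)) + F {J} := by
  have hsingle : {J} ∈ allPathsTo J := mem_allPathsTo.2 (by simp)
  rw [← Finset.sum_erase_add _ _ hsingle, Finset.sum_sigma']
  congr 1
  symm
  refine Finset.sum_bij (fun p _ => insert J p.2) ?_ ?_ ?_ ?_
  · rintro ⟨k, S⟩ hp
    obtain ⟨hk, hle⟩ := mem_allPathsTo.1 (Finset.mem_sigma.1 hp).2
    have hkJ : (⟨k, k.isLt.trans J.isLt⟩ : Fin n) < J := k.isLt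
    refine Finset.mem_erase.2 ⟨fun h => ?_, mem_allPathsTo.2 ⟨Finset.mem_insert_self _ _, ?_⟩⟩
    · have := Finset.mem_insert_of_mem (b := J) hk
      rw [h, Finset.mem_singleton] at this
      exact hkJ.ne this
    · intro x hx
      rcases Finset.mem_insert.1 hx with rfl | hx
      · exact le_rfl
      · exact (hle x hx).trans hkJ.le
  · rintro ⟨k, S⟩ hp ⟨l, T⟩ hq h
    obtain ⟨hk, hkle⟩ := mem_allPathsTo.1 (Finset.mem_sigma.1 hp).2
    obtain ⟨hl, hlle⟩ := mem_allPathsTo.1 (Finset.mem_sigma.1 hq).2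
    have hJS : J ∉ S := fun hx => absurd (hkle J hx) (not_le.2 k.isLt)
    have hJT : J ∉ T := fun hx => absurd (hlle J hx) (not_le.2 l.isLt)
    have hST : S = T := by
      rw [← Finset.erase_insert hJS, ← Finset.erase_insert hJT]
      exact congrArg (Finset.erase · J) h
    subst hST
    have hkl : k = l := le_antisymm (hlle _ hk) (hkle _ hl)
    rw [hkl]
  · intro S hS
    obtain ⟨hne, hS⟩ := Finset.mem_erase.1 hS
    obtain ⟨hJ, hle⟩ := mem_allPathsTo.1 hS
    have hnon : (S.erase J).Nonempty := by
      rw [Finset.nonempty_iff_ne_empty]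
      intro h
      exact hne ((Finset.erase_eq_empty_iff S J).1 h |>.resolve_left (Finset.ne_empty_of_mem hJ))
    have hmem := (S.erase J).max'_mem hnon
    have hlt : (S.erase J).max' hnon < J :=
      lt_of_le_of_ne (hle _ (Finset.mem_of_mem_erase hmem)) (Finset.ne_of_mem_erase hmem)
    exact ⟨⟨⟨(S.erase J).max' hnon, hlt⟩, S.erase J⟩,
      Finset.mem_sigma.2 ⟨Finset.mem_univ _, mem_allPathsTo.2 ⟨hmem, fun x hx =>
        Finset.le_max' _ _ hx⟩⟩, Finset.insert_erase hJ⟩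
  · intros
    rfl

lemma sum_mul_wShock (B : Matrix (Fin n) (Fin n) ℝ) (Ω : Matrix (Fin n) (Fin m) ℝ)
    (i : Fin m) (J : Fin n) (c : Finset (Fin n) → ℝ) :
    ∑ S ∈ allPathsTo J, c S * wShock B Ω i S =
      (∑ k : Fin J, B J ⟨k, k.isLt.trans J.isLt⟩ *
        ∑ S ∈ allPathsTo ⟨k, k.isLt.trans J.isLt⟩, c (insert J S) * wShock B Ω i S) +
      Ω J i * c {J} := by
  rw [sum_allPathsTo, wShock_singleton, mul_comm (c {J})]
  congr 1
  refine Finset.sum_congr rfl fun k _ => ?_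
  rw [Finset.mul_sum]
  refine Finset.sum_congr rfl fun S hS => ?_
  rw [wShock_insert B Ω i (show (⟨k, k.isLt.trans J.isLt⟩ : Fin n) < J from k.isLt) hS]
  ring

lemma block_index_lt {J k t : ℕ} (hk : k < J) (ht : t < 2 ^ k) : 2 ^ k - 1 + t < 2 ^ J := by
  have h1 : 2 ^ (k + 1) ≤ 2 ^ J := Nat.pow_le_pow_right (by norm_num) hk
  have h2 : 2 ^ (k + 1) = 2 ^ k * 2 := pow_succ 2 k
  omega

lemma C_eq (B : Matrix (Fin n) (Fin n) ℝ) (Ω : Matrix (Fin n) (Fin m) ℝ) (i : Fin m)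
    (J : Fin n) (a : Fin (2 ^ (J : ℕ)) → ℝ) :
    C B Ω i J J.isLt a =
      (∑ k : Fin J, B J ⟨k, k.isLt.trans J.isLt⟩ *
        C B Ω i k (k.isLt.trans J.isLt)
          fun t => a ⟨2 ^ (k : ℕ) - 1 + t, block_index_lt k.isLt t.isLt⟩) +
      Ω J i * a ⟨2 ^ (J : ℕ) - 1, Nat.sub_lt (by positivity) one_pos⟩ := by
  obtain ⟨J, hJ⟩ := J
  cases J with
  | zero => simp [C]
  | succ J => rw [C]

/-- Every weighting of the paths to `J` is realised by an assignment vector taking values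
among the weights. -/
lemma exists_assignment (B : Matrix (Fin n) (Fin n) ℝ) (Ω : Matrix (Fin n) (Fin m) ℝ)
    (i : Fin m) (J : ℕ) (hJ : J < n) (c : Finset (Fin n) → ℝ) :
    ∃ a : Fin (2 ^ J) → ℝ, (∀ t, a t ∈ Set.range c) ∧
      C B Ω i J hJ a = ∑ S ∈ allPathsTo ⟨J, hJ⟩, c S * wShock B Ω i S := by
  induction J using Nat.strong_induction_on generalizing c with
  | _ J ih =>
    choose a ha hC using fun k : Fin J =>
      ih k k.isLt (k.isLt.trans hJ) fun S => c (insert ⟨J, hJ⟩ S)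
    have hlog (t : Fin (2 ^ J)) (h : (t : ℕ) + 1 ≠ 2 ^ J) : Nat.log 2 (t + 1) < J :=
      Nat.log_lt_of_lt_pow (by omega) (by omega)
    have hoff (t : ℕ) : t + 1 - 2 ^ Nat.log 2 (t + 1) < 2 ^ Nat.log 2 (t + 1) := by
      have := Nat.lt_pow_succ_log_self one_lt_two (t + 1)
      have := pow_succ 2 (Nat.log 2 (t + 1))
      have : 0 < 2 ^ Nat.log 2 (t + 1) := by positivity
      omega
    let b : Fin (2 ^ J) → ℝ := fun t =>
      if h : (t : ℕ) + 1 = 2 ^ J then c {⟨J, hJ⟩}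
      else a ⟨Nat.log 2 (t + 1), hlog t h⟩ ⟨t + 1 - 2 ^ Nat.log 2 (t + 1), hoff t⟩
    have hpos (k : ℕ) : 0 < 2 ^ k := by positivity
    have hblock (k : Fin J) (t : Fin (2 ^ (k : ℕ))) :
        b ⟨2 ^ (k : ℕ) - 1 + t, block_index_lt k.isLt t.isLt⟩ = a k t := by
      have hidx : 2 ^ (k : ℕ) - 1 + (t : ℕ) + 1 = 2 ^ (k : ℕ) + t := by
        have := hpos k
        omega
      have hpow : 2 ^ ((k : ℕ) + 1) ≤ 2 ^ J := Nat.pow_le_pow_right (by norm_num) k.isLt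
      have hsucc := pow_succ 2 (k : ℕ)
      have hkt : Nat.log 2 (2 ^ (k : ℕ) - 1 + (t : ℕ) + 1) = k := by
        rw [hidx]
        exact Nat.log_eq_of_pow_le_of_lt_pow (by omega) (by omega)
      have hne : 2 ^ (k : ℕ) - 1 + (t : ℕ) + 1 ≠ 2 ^ J := by omega
      have haux (l : Fin J) (s : Fin (2 ^ (l : ℕ))) (hl : (l : ℕ) = k) (hs : (s : ℕ) = t) :
          a l s = a k t := by
        obtain rfl := Fin.ext hl
        rw [Fin.ext hs]
      simp only [b, dif_neg hne]
      refine haux _ _ hkt ?_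
      simp only [hkt]
      omega
    have hlast : b ⟨2 ^ J - 1, Nat.sub_lt (hpos J) one_pos⟩ = c {⟨J, hJ⟩} := by
      have := hpos J
      exact dif_pos (by simp only; omega)
    refine ⟨b, fun t => ?_, ?_⟩
    · by_cases h : (t : ℕ) + 1 = 2 ^ J
      · simp [b, h]
      · simp only [b, dif_neg h]
        obtain ⟨S, hS⟩ := ha ⟨Nat.log 2 (t + 1), hlog t h⟩ ⟨_, hoff t⟩
        exact ⟨_, hS⟩
    · rw [C_eq B Ω i ⟨J, hJ⟩, sum_mul_wShock]
      simp only [hblock, hlast, hC]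

/-- Every assignment vector realises a weighting of the paths to `J` taking values among its
coordinates. -/
lemma exists_weighting (B : Matrix (Fin n) (Fin n) ℝ) (Ω : Matrix (Fin n) (Fin m) ℝ)
    (i : Fin m) (J : ℕ) (hJ : J < n) (a : Fin (2 ^ J) → ℝ) :
    ∃ c : Finset (Fin n) → ℝ, (∀ S, c S ∈ Set.range a) ∧
      C B Ω i J hJ a = ∑ S ∈ allPathsTo ⟨J, hJ⟩, c S * wShock B Ω i S := by
  induction J using Nat.strong_induction_on with
  | _ J ih =>
    choose c hc hC using fun k : Fin J => ih k k.isLt (k.isLt.trans hJ)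
      fun t => a ⟨2 ^ (k : ℕ) - 1 + t, block_index_lt k.isLt t.isLt⟩
    classical
    let d : Finset (Fin n) → ℝ := fun S =>
      if h : ∃ k : Fin J, S.erase ⟨J, hJ⟩ ∈ allPathsTo ⟨k, k.isLt.trans hJ⟩
      then c h.choose (S.erase ⟨J, hJ⟩)
      else a ⟨2 ^ J - 1, Nat.sub_lt (by positivity) one_pos⟩
    have hsingle : d {⟨J, hJ⟩} = a ⟨2 ^ J - 1, Nat.sub_lt (by positivity) one_pos⟩ := by
      refine dif_neg ?_
      rintro ⟨k, hk⟩
      simpa using (mem_allPathsTo.1 hk).1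
    have hinsert (k : Fin J) (S) (hS : S ∈ allPathsTo ⟨k, k.isLt.trans hJ⟩) :
        d (insert ⟨J, hJ⟩ S) = c k S := by
      obtain ⟨hk, hle⟩ := mem_allPathsTo.1 hS
      have hJS : (⟨J, hJ⟩ : Fin n) ∉ S := fun hx => absurd (hle _ hx) (not_le.2 k.isLt)
      have herase := Finset.erase_insert hJS
      have hex : ∃ l : Fin J,
          (insert ⟨J, hJ⟩ S).erase ⟨J, hJ⟩ ∈ allPathsTo ⟨l, l.isLt.trans hJ⟩ :=
        ⟨k, herase.symm ▸ hS⟩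
      obtain ⟨hl, hlle⟩ := mem_allPathsTo.1 hex.choose_spec
      have hkl : hex.choose = k := le_antisymm (hle _ (herase.le hl)) (hlle _ (herase.ge hk))
      simp only [d, dif_pos hex]
      rw [hkl, herase]
    refine ⟨d, fun S => ?_, ?_⟩
    · by_cases h : ∃ k : Fin J, S.erase ⟨J, hJ⟩ ∈ allPathsTo ⟨k, k.isLt.trans hJ⟩
      · simp only [d, dif_pos h]
        obtain ⟨t, ht⟩ := hc h.choose (S.erase ⟨J, hJ⟩)
        exact ⟨_, ht⟩
      · simp only [d, dif_neg h]
        exact Set.mem_range_self _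
    · rw [C_eq B Ω i ⟨J, hJ⟩, sum_mul_wShock, hsingle]
      congr 1
      refine Finset.sum_congr rfl fun k _ => ?_
      rw [hC]
      congr 1
      exact Finset.sum_congr rfl fun S hS => by rw [hinsert k S hS]

lemma Q_eq_sum_ite (ξ : ℝ) (w : Finset (Fin n) → ℝ) {P A : Finset (Finset (Fin n))}
    (hP : P ⊆ A) : Q ξ w P = ∑ S ∈ A, (if S ∈ P then ξ else 0) * w S := by
  simp only [Q, Finset.mul_sum, ite_mul, zero_mul, Finset.sum_ite_mem,
    Finset.inter_eq_right.2 hP]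

/-- equivalence of the graphical and potential-outcomes frameworks:
(i) every sub-collection of paths from `ε_i` to `x_j` has a `{0, ξ}`-valued
assignment vector with the same effect; (ii) every `{0, ξ}`-valued assignment
vector has a sub-collection of paths with the same effect. -/
theorem framework_equivalence (n m : ℕ) (hn : 0 < n) (hm : 0 < m)
    (B : Matrix (Fin n) (Fin n) ℝ) (Ω : Matrix (Fin n) (Fin m) ℝ)
    (hB : ∀ j k : Fin n, j ≤ k → B j k = 0)
    (i : Fin m) (j : Fin n) (ξ : ℝ) :
    (∀ P ⊆ allPathsTo j, ∃ a : Fin (2 ^ (j : ℕ)) → ℝ,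
        (∀ t, a t = 0 ∨ a t = ξ) ∧
          Q ξ (wShock B Ω i) P = C B Ω i (j : ℕ) j.isLt a) ∧
    (∀ a : Fin (2 ^ (j : ℕ)) → ℝ, (∀ t, a t = 0 ∨ a t = ξ) →
        ∃ P ⊆ allPathsTo j, C B Ω i (j : ℕ) j.isLt a = Q ξ (wShock B Ω i) P) := by
  refine ⟨fun P hP => ?_, fun a ha => ?_⟩
  · obtain ⟨a, ha, hC⟩ := exists_assignment B Ω i j j.isLt fun S => if S ∈ P then ξ else 0
    refine ⟨a, fun t => ?_, by rw [hC, Q_eq_sum_ite ξ _ hP]⟩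
    obtain ⟨S, hS⟩ := ha t
    rw [← hS]
    by_cases h : S ∈ P <;> simp [h]
  · obtain ⟨c, hc, hC⟩ := exists_weighting B Ω i j j.isLt a
    classical
    refine ⟨(allPathsTo j).filter fun S => c S = ξ, Finset.filter_subset _ _, ?_⟩
    rw [hC, Q_eq_sum_ite ξ _ (Finset.filter_subset _ _)]
    refine Finset.sum_congr rfl fun S hS => ?_
    have hcS : c S = 0 ∨ c S = ξ := by
      obtain ⟨t, ht⟩ := hc S
      exact ht ▸ ha t
    by_cases h : c S = ξ
    · simp [h, hS]
    · have hnot : S ∉ (allPathsTo j).filter fun S => c S = ξ :=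
        fun hmem => h (Finset.mem_filter.1 hmem).2
      rw [if_neg hnot, hcS.resolve_right h]

end TCA
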